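/- arXiv:1110.3520 — 3 statements merged into one kernel-verified Lean document; each statement's English description precedes it below -/
import Mathlib

section
/- The kernel of the Q-algebra homomorphism from Q[x,y,z] to Q[a,b] sending x to D, y to c4 and z to c6 is the principal ideal generated by y^3 - z^2 - 1728*x^5. -/
open MvPolynomial

/-- The binary form `D = a*b*(a^10 - 11 a^5 b^5 - b^10)` in `ℚ[a,b]`. -/
noncomputable def Dpoly : MvPolynomial (Fin 2) ℚ :=
  X 0 * X 1 * (X 0 ^ 10 - 11 * X 0 ^ 5 * X 1 ^ 5 - X 1 ^ 10)

/-- The binary form `c4` in `ℚ[a,b]`. -/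
noncomputable def c4poly : MvPolynomial (Fin 2) ℚ :=
  X 0 ^ 20 + 228 * X 0 ^ 15 * X 1 ^ 5 + 494 * X 0 ^ 10 * X 1 ^ 10
    - 228 * X 0 ^ 5 * X 1 ^ 15 + X 1 ^ 20

/-- The binary form `c6` in `ℚ[a,b]`. -/
noncomputable def c6poly : MvPolynomial (Fin 2) ℚ :=
  -(X 0 ^ 30) + 522 * X 0 ^ 25 * X 1 ^ 5 + 10005 * X 0 ^ 20 * X 1 ^ 10
    + 10005 * X 0 ^ 10 * X 1 ^ 20 - 522 * X 0 ^ 5 * X 1 ^ 25 - X 1 ^ 30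

/-- Evaluate `A ∈ ℚ[Y][X]` at `Y = y`, `X = x`. -/
noncomputable def evXY {S : Type} [CommRing S] [Algebra ℚ S] (x y : S) :
    Polynomial (Polynomial ℚ) →+* S :=
  Polynomial.eval₂RingHom (Polynomial.aeval y : Polynomial ℚ →ₐ[ℚ] S).toRingHom x

lemma evXY_X {S : Type} [CommRing S] [Algebra ℚ S] (x y : S) :
    evXY x y Polynomial.X = x := by
  simp [evXY]

lemma evXY_C {S : Type} [CommRing S] [Algebra ℚ S] (x y : S) (a : Polynomial ℚ) :
    evXY x y (Polynomial.C a) = Polynomial.aeval y a := by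
  simp [evXY]

lemma map_evXY {S T : Type} [CommRing S] [Algebra ℚ S] [CommRing T] [Algebra ℚ T]
    (g : S →ₐ[ℚ] T) (x y : S) (A : Polynomial (Polynomial ℚ)) :
    g (evXY x y A) = evXY (g x) (g y) A := by
  induction A using Polynomial.induction_on' with
  | add p q hp hq => simp only [map_add, hp, hq]
  | monomial n a =>
    rw [← Polynomial.C_mul_X_pow_eq_monomial]
    simp only [map_mul, map_pow, evXY_X, evXY_C, Polynomial.aeval_algHom_apply]

lemma evXY_divX {S : Type} [CommRing S] [Algebra ℚ S] (x y : S)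
    (A : Polynomial (Polynomial ℚ)) :
    evXY x y A = x * evXY x y A.divX + Polynomial.aeval y (A.coeff 0) := by
  conv_lhs => rw [← Polynomial.X_mul_divX_add A]
  simp only [map_add, map_mul, evXY_X, evXY_C]

lemma parity_zero (a b : Polynomial ℚ)
    (h : Polynomial.aeval ((Polynomial.X : Polynomial ℚ) ^ 20) a
      - Polynomial.X ^ 30 * Polynomial.aeval ((Polynomial.X : Polynomial ℚ) ^ 20) b = 0) :
    a = 0 ∧ b = 0 := by
  rw [← Polynomial.expand_aeval, ← Polynomial.expand_aeval] at h
  simp only [Polynomial.aeval_X_left_apply] at h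
  constructor
  · ext m
    have := congrArg (fun p => Polynomial.coeff p (20 * m)) h
    simp only [Polynomial.coeff_sub, Polynomial.coeff_X_pow_mul',
      Polynomial.coeff_expand (show 0 < 20 by norm_num), Polynomial.coeff_zero] at this
    have h1 : 20 ∣ 20 * m := ⟨m, rfl⟩
    have h3 : 20 * m / 20 = m := by omega
    by_cases h30 : 30 ≤ 20 * m
    · have h2 : ¬ 20 ∣ 20 * m - 30 := by omega
      simpa [h2] using this
    · simpa [h30] using this
  · ext m
    have := congrArg (fun p => Polynomial.coeff p (20 * m + 30)) h
    simp only [Polynomial.coeff_sub, Polynomial.coeff_X_pow_mul',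
      Polynomial.coeff_expand (show 0 < 20 by norm_num), Polynomial.coeff_zero] at this
    have h2 : ¬ 20 ∣ 20 * m + 30 := by omega
    simpa [h2] using this

lemma Dpoly_ne_zero : Dpoly ≠ 0 := by
  intro h
  have := congrArg (MvPolynomial.eval (fun _ => (1 : ℚ))) h
  simp [Dpoly] at this

lemma coeff_zero_of_rel (A B : Polynomial (Polynomial ℚ))
    (h : evXY Dpoly c4poly A + c6poly * evXY Dpoly c4poly B = 0) :
    A.coeff 0 = 0 ∧ B.coeff 0 = 0 := by
  let g : MvPolynomial (Fin 2) ℚ →ₐ[ℚ] Polynomial ℚ := aeval ![Polynomial.X, 0]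
  have hD : g Dpoly = 0 := by simp [g, Dpoly]
  have h4 : g c4poly = Polynomial.X ^ 20 := by simp [g, c4poly]
  have h6 : g c6poly = - Polynomial.X ^ 30 := by simp [g, c6poly]
  have h' := congrArg g h
  rw [map_add, map_mul, map_evXY, map_evXY, hD, h4, h6, map_zero,
    evXY_divX, evXY_divX _ _ B] at h'
  apply parity_zero
  rw [← h']
  ring

lemma rel_zero (n : ℕ) : ∀ A B : Polynomial (Polynomial ℚ),
    A.natDegree ≤ n → B.natDegree ≤ n →
    evXY Dpoly c4poly A + c6poly * evXY Dpoly c4poly B = 0 → A = 0 ∧ B = 0 := by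
  induction n with
  | zero =>
    intro A B hA hB h
    obtain ⟨h1, h2⟩ := coeff_zero_of_rel A B h
    rw [Polynomial.eq_C_of_natDegree_le_zero hA, Polynomial.eq_C_of_natDegree_le_zero hB,
      h1, h2]
    simp
  | succ n ih =>
    intro A B hA hB h
    obtain ⟨h1, h2⟩ := coeff_zero_of_rel A B h
    rw [evXY_divX, evXY_divX _ _ B, h1, h2] at h
    have h' : Dpoly * (evXY Dpoly c4poly A.divX + c6poly * evXY Dpoly c4poly B.divX) = 0 := by
      rw [← h, map_zero]; ring
    have h'' := (mul_eq_zero.mp h').resolve_left Dpoly_ne_zero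
    obtain ⟨e1, e2⟩ := ih A.divX B.divX
      (by rw [Polynomial.natDegree_divX_eq_natDegree_tsub_one]; omega)
      (by rw [Polynomial.natDegree_divX_eq_natDegree_tsub_one]; omega) h''
    rw [← Polynomial.X_mul_divX_add A, ← Polynomial.X_mul_divX_add B, h1, h2, e1, e2]
    simp

lemma normal_form (p : MvPolynomial (Fin 3) ℚ) :
    ∃ A B : Polynomial (Polynomial ℚ), ∃ r : MvPolynomial (Fin 3) ℚ,
      p = evXY (X 0) (X 1) A + X 2 * evXY (X 0) (X 1) B
        + r * (X 1 ^ 3 - X 2 ^ 2 - 1728 * X 0 ^ 5) := by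
  induction p using MvPolynomial.induction_on with
  | C a =>
    refine ⟨Polynomial.C (Polynomial.C a), 0, 0, ?_⟩
    rw [evXY_C, Polynomial.aeval_C, map_zero, MvPolynomial.algebraMap_eq]
    ring
  | add p q hp hq =>
    obtain ⟨A, B, r, hp⟩ := hp
    obtain ⟨A', B', r', hq⟩ := hq
    refine ⟨A + A', B + B', r + r', ?_⟩
    rw [map_add, map_add, hp, hq]
    ring
  | mul_X p i hp =>
    obtain ⟨A, B, r, hp⟩ := hp
    fin_cases i
    · refine ⟨A * Polynomial.X, B * Polynomial.X, r * X 0, ?_⟩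
      simp only [map_mul, evXY_X]
      rw [hp]
      simp only [Fin.zero_eta]
      ring
    · refine ⟨A * Polynomial.C Polynomial.X, B * Polynomial.C Polynomial.X, r * X 1, ?_⟩
      simp only [map_mul, evXY_C, Polynomial.aeval_X]
      rw [hp]
      simp only [Fin.mk_one]
      ring
    · refine ⟨B * (Polynomial.C Polynomial.X ^ 3 - 1728 * Polynomial.X ^ 5), A,
        r * X 2 - evXY (X 0) (X 1) B, ?_⟩
      simp only [map_mul, map_sub, map_pow, evXY_C, evXY_X, Polynomial.aeval_X, map_ofNat]
      rw [hp]
      simp only [Fin.reduceFinMk]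
      ring

lemma relation_forms : c4poly ^ 3 - c6poly ^ 2 - 1728 * Dpoly ^ 5 = 0 := by
  unfold c4poly c6poly Dpoly
  ring

/-- The kernel of the `ℚ`-algebra map `ℚ[x,y,z] → ℚ[a,b]`, `x ↦ D`, `y ↦ c4`,
`z ↦ c6`, is the principal ideal generated by `y³ - z² - 1728 x⁵`. -/
theorem ker_of_invariants_map :
    RingHom.ker (aeval ![Dpoly, c4poly, c6poly] :
        MvPolynomial (Fin 3) ℚ →ₐ[ℚ] MvPolynomial (Fin 2) ℚ) =
      Ideal.span {X 1 ^ 3 - X 2 ^ 2 - 1728 * X 0 ^ 5} := by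
  have hf : (aeval ![Dpoly, c4poly, c6poly] :
        MvPolynomial (Fin 3) ℚ →ₐ[ℚ] MvPolynomial (Fin 2) ℚ)
        (X 1 ^ 3 - X 2 ^ 2 - 1728 * X 0 ^ 5) = 0 := by
    simp only [map_sub, map_mul, map_pow, aeval_X, map_ofNat]
    exact relation_forms
  apply le_antisymm
  · intro p hp
    rw [RingHom.mem_ker] at hp
    obtain ⟨A, B, r, rfl⟩ := normal_form p
    rw [map_add, map_mul _ r, hf, mul_zero, add_zero, map_add, map_mul, map_evXY, map_evXY,
      aeval_X, aeval_X, aeval_X] at hp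
    obtain ⟨rfl, rfl⟩ := rel_zero (max A.natDegree B.natDegree) A B
      (le_max_left _ _) (le_max_right _ _) hp
    rw [Ideal.mem_span_singleton]
    simp only [map_zero, mul_zero, zero_add]
    exact dvd_mul_left _ _
  · rw [Ideal.span_singleton_le_iff_mem, RingHom.mem_ker]
    exact hf
end

section
/- In the polynomial ring Q[a, b, lam, mu] the identity 27 * D(lam*f7 + mu*f17, lam*g7 + mu*g17) = D(a,b)^2 * bD*(lam, mu) holds, where D(u,v) denotes the substitution a = u, b = v into the binary form D, and bD*(lam,mu) denotes the polynomial bD(lam,mu) with the indeterminates c4 and c6 replaced by the binary forms c4(a,b) and c6(a,b) respectively. -/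
open MvPolynomial

/-- The binary form `f7` in `ℚ[a,b]`. -/
noncomputable def f7 : MvPolynomial (Fin 2) ℚ :=
  X 1 ^ 2 * (7 * X 0 ^ 5 - X 1 ^ 5)

/-- The binary form `g7` in `ℚ[a,b]`. -/
noncomputable def g7 : MvPolynomial (Fin 2) ℚ :=
  X 0 ^ 2 * (X 0 ^ 5 + 7 * X 1 ^ 5)

/-- The binary form `f17` in `ℚ[a,b]`. -/
noncomputable def f17 : MvPolynomial (Fin 2) ℚ :=
  X 1 ^ 2 * (17 * X 0 ^ 15 + 187 * X 0 ^ 10 * X 1 ^ 5 + 119 * X 0 ^ 5 * X 1 ^ 10 + X 1 ^ 15)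

/-- The binary form `g17` in `ℚ[a,b]`. -/
noncomputable def g17 : MvPolynomial (Fin 2) ℚ :=
  -(X 0 ^ 2 * (X 0 ^ 15 - 119 * X 0 ^ 10 * X 1 ^ 5 + 187 * X 0 ^ 5 * X 1 ^ 10 - 17 * X 1 ^ 15))

set_option maxHeartbeats 1000000 in
/-- The polynomial `𝐃(λ,μ)` in `ℚ[c4, c6, λ, μ]`, with `c4 = X 0`, `c6 = X 1`,
`λ = X 2`, `μ = X 3`. -/
noncomputable def bD : MvPolynomial (Fin 4) ℚ :=
  -((125 * X 0 ^ 3 + 64 * X 1 ^ 2) * X 2 ^ 12)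
    - 1620 * X 0 ^ 2 * X 1 * X 2 ^ 11 * X 3
    - 66 * (25 * X 0 ^ 4 + 56 * X 0 * X 1 ^ 2) * X 2 ^ 10 * X 3 ^ 2
    - 220 * (11 * X 0 ^ 3 * X 1 + 16 * X 1 ^ 3) * X 2 ^ 9 * X 3 ^ 3
    + 1485 * (5 * X 0 ^ 5 + 4 * X 0 ^ 2 * X 1 ^ 2) * X 2 ^ 8 * X 3 ^ 4
    + 792 * (53 * X 0 ^ 4 * X 1 + 28 * X 0 * X 1 ^ 3) * X 2 ^ 7 * X 3 ^ 5
    + 660 * (9 * X 0 ^ 6 + 164 * X 0 ^ 3 * X 1 ^ 2 + 16 * X 1 ^ 4) * X 2 ^ 6 * X 3 ^ 6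
    + 2376 * (19 * X 0 ^ 5 * X 1 + 44 * X 0 ^ 2 * X 1 ^ 3) * X 2 ^ 5 * X 3 ^ 7
    + 495 * (27 * X 0 ^ 7 + 104 * X 0 ^ 4 * X 1 ^ 2 + 112 * X 0 * X 1 ^ 4) * X 2 ^ 4 * X 3 ^ 8
    + 220 * (81 * X 0 ^ 6 * X 1 + 136 * X 0 ^ 3 * X 1 ^ 3 + 80 * X 1 ^ 5) * X 2 ^ 3 * X 3 ^ 9
    - 594 * (9 * X 0 ^ 8 - 32 * X 0 ^ 5 * X 1 ^ 2 - 16 * X 0 ^ 2 * X 1 ^ 4) * X 2 ^ 2 * X 3 ^ 10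
    - 60 * (135 * X 0 ^ 7 * X 1 - 328 * X 0 ^ 4 * X 1 ^ 3 + 112 * X 0 * X 1 ^ 5) * X 2 * X 3 ^ 11
    - (729 * X 0 ^ 9 + 108 * X 0 ^ 6 * X 1 ^ 2 - 2896 * X 0 ^ 3 * X 1 ^ 4 + 1600 * X 1 ^ 6)
        * X 3 ^ 12

/-- The data entering the coefficientwise identities: with `x = a ^ 5` and `y = b ^ 5`, the
dehomogenised cofactors `p, q, r, s` of `f7, f17, g7, g17` and the values `c, d` of `c4, c6`. -/
structure BDData {R : Type*} [CommRing R] (x y p q r s c d : R) : Prop where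
  hp : p = 7 * x - y
  hq : q = 17 * x ^ 3 + 187 * x ^ 2 * y + 119 * x * y ^ 2 + y ^ 3
  hr : r = x + 7 * y
  hs : s = -(x ^ 3 - 119 * x ^ 2 * y + 187 * x * y ^ 2 - 17 * y ^ 3)
  hc : c = x ^ 4 + 228 * x ^ 3 * y + 494 * x ^ 2 * y ^ 2 - 228 * x * y ^ 3 + y ^ 4
  hd : d = -(x ^ 6) + 522 * x ^ 5 * y + 10005 * x ^ 4 * y ^ 2 + 10005 * x ^ 2 * y ^ 4
      - 522 * x * y ^ 5 - y ^ 6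

set_option maxRecDepth 100000 in
set_option maxHeartbeats 0 in
theorem bD_coef0 {R : Type*} [CommRing R] (x y p q r s c d : R)
    (h : BDData x y p q r s c d) :
    27 * (y ^ 4 * (p ^ 11 * r)
      - 11 * (x ^ 2 * y ^ 2) * (p ^ 6 * r ^ 6)
      - x ^ 4 * (p * r ^ 11)) =
    (x ^ 2 - 11 * x * y - y ^ 2) ^ 2 * (-(125 * c ^ 3 + 64 * d ^ 2)) := by
  obtain ⟨rfl, rfl, rfl, rfl, rfl, rfl⟩ := h
  ring

set_option maxRecDepth 100000 in
set_option maxHeartbeats 0 in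
theorem bD_coef1 {R : Type*} [CommRing R] (x y p q r s c d : R)
    (h : BDData x y p q r s c d) :
    27 * (y ^ 4 * (p ^ 11 * s + 11 * p ^ 10 * q * r)
      - 11 * (x ^ 2 * y ^ 2) * (6 * p ^ 6 * r ^ 5 * s + 6 * p ^ 5 * q * r ^ 6)
      - x ^ 4 * (11 * p * r ^ 10 * s + q * r ^ 11)) =
    (x ^ 2 - 11 * x * y - y ^ 2) ^ 2 * (-(1620 * c ^ 2 * d)) := by
  obtain ⟨rfl, rfl, rfl, rfl, rfl, rfl⟩ := h
  ring

set_option maxRecDepth 100000 in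
set_option maxHeartbeats 0 in
theorem bD_coef2 {R : Type*} [CommRing R] (x y p q r s c d : R)
    (h : BDData x y p q r s c d) :
    27 * (y ^ 4 * (11 * p ^ 10 * q * s + 55 * p ^ 9 * q ^ 2 * r)
      - 11 * (x ^ 2 * y ^ 2) * (15 * p ^ 6 * r ^ 4 * s ^ 2 + 36 * p ^ 5 * q * r ^ 5 * s + 15 * p ^ 4 * q ^ 2 * r ^ 6)
      - x ^ 4 * (55 * p * r ^ 9 * s ^ 2 + 11 * q * r ^ 10 * s)) =
    (x ^ 2 - 11 * x * y - y ^ 2) ^ 2 * (-(66 * (25 * c ^ 4 + 56 * c * d ^ 2))) := by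
  obtain ⟨rfl, rfl, rfl, rfl, rfl, rfl⟩ := h
  ring

set_option maxRecDepth 100000 in
set_option maxHeartbeats 0 in
theorem bD_coef3 {R : Type*} [CommRing R] (x y p q r s c d : R)
    (h : BDData x y p q r s c d) :
    27 * (y ^ 4 * (55 * p ^ 9 * q ^ 2 * s + 165 * p ^ 8 * q ^ 3 * r)
      - 11 * (x ^ 2 * y ^ 2) * (20 * p ^ 6 * r ^ 3 * s ^ 3 + 90 * p ^ 5 * q * r ^ 4 * s ^ 2 + 90 * p ^ 4 * q ^ 2 * r ^ 5 * s + 20 * p ^ 3 * q ^ 3 * r ^ 6)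
      - x ^ 4 * (165 * p * r ^ 8 * s ^ 3 + 55 * q * r ^ 9 * s ^ 2)) =
    (x ^ 2 - 11 * x * y - y ^ 2) ^ 2 * (-(220 * (11 * c ^ 3 * d + 16 * d ^ 3))) := by
  obtain ⟨rfl, rfl, rfl, rfl, rfl, rfl⟩ := h
  ring

set_option maxRecDepth 100000 in
set_option maxHeartbeats 0 in
theorem bD_coef4 {R : Type*} [CommRing R] (x y p q r s c d : R)
    (h : BDData x y p q r s c d) :
    27 * (y ^ 4 * (165 * p ^ 8 * q ^ 3 * s + 330 * p ^ 7 * q ^ 4 * r)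
      - 11 * (x ^ 2 * y ^ 2) * (15 * p ^ 6 * r ^ 2 * s ^ 4 + 120 * p ^ 5 * q * r ^ 3 * s ^ 3 + 225 * p ^ 4 * q ^ 2 * r ^ 4 * s ^ 2 + 120 * p ^ 3 * q ^ 3 * r ^ 5 * s + 15 * p ^ 2 * q ^ 4 * r ^ 6)
      - x ^ 4 * (330 * p * r ^ 7 * s ^ 4 + 165 * q * r ^ 8 * s ^ 3)) =
    (x ^ 2 - 11 * x * y - y ^ 2) ^ 2 * (1485 * (5 * c ^ 5 + 4 * c ^ 2 * d ^ 2)) := by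
  obtain ⟨rfl, rfl, rfl, rfl, rfl, rfl⟩ := h
  ring

set_option maxRecDepth 100000 in
set_option maxHeartbeats 0 in
theorem bD_coef5 {R : Type*} [CommRing R] (x y p q r s c d : R)
    (h : BDData x y p q r s c d) :
    27 * (y ^ 4 * (330 * p ^ 7 * q ^ 4 * s + 462 * p ^ 6 * q ^ 5 * r)
      - 11 * (x ^ 2 * y ^ 2) * (6 * p ^ 6 * r * s ^ 5 + 90 * p ^ 5 * q * r ^ 2 * s ^ 4 + 300 * p ^ 4 * q ^ 2 * r ^ 3 * s ^ 3 + 300 * p ^ 3 * q ^ 3 * r ^ 4 * s ^ 2 + 90 * p ^ 2 * q ^ 4 * r ^ 5 * s + 6 * p * q ^ 5 * r ^ 6)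
      - x ^ 4 * (462 * p * r ^ 6 * s ^ 5 + 330 * q * r ^ 7 * s ^ 4)) =
    (x ^ 2 - 11 * x * y - y ^ 2) ^ 2 * (792 * (53 * c ^ 4 * d + 28 * c * d ^ 3)) := by
  obtain ⟨rfl, rfl, rfl, rfl, rfl, rfl⟩ := h
  ring

set_option maxRecDepth 100000 in
set_option maxHeartbeats 0 in
theorem bD_coef6 {R : Type*} [CommRing R] (x y p q r s c d : R)
    (h : BDData x y p q r s c d) :
    27 * (y ^ 4 * (462 * p ^ 6 * q ^ 5 * s + 462 * p ^ 5 * q ^ 6 * r)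
      - 11 * (x ^ 2 * y ^ 2) * (p ^ 6 * s ^ 6 + 36 * p ^ 5 * q * r * s ^ 5 + 225 * p ^ 4 * q ^ 2 * r ^ 2 * s ^ 4 + 400 * p ^ 3 * q ^ 3 * r ^ 3 * s ^ 3 + 225 * p ^ 2 * q ^ 4 * r ^ 4 * s ^ 2 + 36 * p * q ^ 5 * r ^ 5 * s + q ^ 6 * r ^ 6)
      - x ^ 4 * (462 * p * r ^ 5 * s ^ 6 + 462 * q * r ^ 6 * s ^ 5)) =
    (x ^ 2 - 11 * x * y - y ^ 2) ^ 2 * (660 * (9 * c ^ 6 + 164 * c ^ 3 * d ^ 2 + 16 * d ^ 4)) := by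
  obtain ⟨rfl, rfl, rfl, rfl, rfl, rfl⟩ := h
  ring

set_option maxRecDepth 100000 in
set_option maxHeartbeats 0 in
theorem bD_coef7 {R : Type*} [CommRing R] (x y p q r s c d : R)
    (h : BDData x y p q r s c d) :
    27 * (y ^ 4 * (462 * p ^ 5 * q ^ 6 * s + 330 * p ^ 4 * q ^ 7 * r)
      - 11 * (x ^ 2 * y ^ 2) * (6 * p ^ 5 * q * s ^ 6 + 90 * p ^ 4 * q ^ 2 * r * s ^ 5 + 300 * p ^ 3 * q ^ 3 * r ^ 2 * s ^ 4 + 300 * p ^ 2 * q ^ 4 * r ^ 3 * s ^ 3 + 90 * p * q ^ 5 * r ^ 4 * s ^ 2 + 6 * q ^ 6 * r ^ 5 * s)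
      - x ^ 4 * (330 * p * r ^ 4 * s ^ 7 + 462 * q * r ^ 5 * s ^ 6)) =
    (x ^ 2 - 11 * x * y - y ^ 2) ^ 2 * (2376 * (19 * c ^ 5 * d + 44 * c ^ 2 * d ^ 3)) := by
  obtain ⟨rfl, rfl, rfl, rfl, rfl, rfl⟩ := h
  ring

set_option maxRecDepth 100000 in
set_option maxHeartbeats 0 in
theorem bD_coef8 {R : Type*} [CommRing R] (x y p q r s c d : R)
    (h : BDData x y p q r s c d) :
    27 * (y ^ 4 * (330 * p ^ 4 * q ^ 7 * s + 165 * p ^ 3 * q ^ 8 * r)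
      - 11 * (x ^ 2 * y ^ 2) * (15 * p ^ 4 * q ^ 2 * s ^ 6 + 120 * p ^ 3 * q ^ 3 * r * s ^ 5 + 225 * p ^ 2 * q ^ 4 * r ^ 2 * s ^ 4 + 120 * p * q ^ 5 * r ^ 3 * s ^ 3 + 15 * q ^ 6 * r ^ 4 * s ^ 2)
      - x ^ 4 * (165 * p * r ^ 3 * s ^ 8 + 330 * q * r ^ 4 * s ^ 7)) =
    (x ^ 2 - 11 * x * y - y ^ 2) ^ 2 * (495 * (27 * c ^ 7 + 104 * c ^ 4 * d ^ 2 + 112 * c * d ^ 4)) := by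
  obtain ⟨rfl, rfl, rfl, rfl, rfl, rfl⟩ := h
  ring

set_option maxRecDepth 100000 in
set_option maxHeartbeats 0 in
theorem bD_coef9 {R : Type*} [CommRing R] (x y p q r s c d : R)
    (h : BDData x y p q r s c d) :
    27 * (y ^ 4 * (165 * p ^ 3 * q ^ 8 * s + 55 * p ^ 2 * q ^ 9 * r)
      - 11 * (x ^ 2 * y ^ 2) * (20 * p ^ 3 * q ^ 3 * s ^ 6 + 90 * p ^ 2 * q ^ 4 * r * s ^ 5 + 90 * p * q ^ 5 * r ^ 2 * s ^ 4 + 20 * q ^ 6 * r ^ 3 * s ^ 3)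
      - x ^ 4 * (55 * p * r ^ 2 * s ^ 9 + 165 * q * r ^ 3 * s ^ 8)) =
    (x ^ 2 - 11 * x * y - y ^ 2) ^ 2 * (220 * (81 * c ^ 6 * d + 136 * c ^ 3 * d ^ 3 + 80 * d ^ 5)) := by
  obtain ⟨rfl, rfl, rfl, rfl, rfl, rfl⟩ := h
  ring

set_option maxRecDepth 100000 in
set_option maxHeartbeats 0 in
theorem bD_coef10 {R : Type*} [CommRing R] (x y p q r s c d : R)
    (h : BDData x y p q r s c d) :
    27 * (y ^ 4 * (55 * p ^ 2 * q ^ 9 * s + 11 * p * q ^ 10 * r)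
      - 11 * (x ^ 2 * y ^ 2) * (15 * p ^ 2 * q ^ 4 * s ^ 6 + 36 * p * q ^ 5 * r * s ^ 5 + 15 * q ^ 6 * r ^ 2 * s ^ 4)
      - x ^ 4 * (11 * p * r * s ^ 10 + 55 * q * r ^ 2 * s ^ 9)) =
    (x ^ 2 - 11 * x * y - y ^ 2) ^ 2 * (-(594 * (9 * c ^ 8-32 * c ^ 5 * d ^ 2-16 * c ^ 2 * d ^ 4))) := by
  obtain ⟨rfl, rfl, rfl, rfl, rfl, rfl⟩ := h
  ring

set_option maxRecDepth 100000 in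
set_option maxHeartbeats 0 in
theorem bD_coef11 {R : Type*} [CommRing R] (x y p q r s c d : R)
    (h : BDData x y p q r s c d) :
    27 * (y ^ 4 * (11 * p * q ^ 10 * s + q ^ 11 * r)
      - 11 * (x ^ 2 * y ^ 2) * (6 * p * q ^ 5 * s ^ 6 + 6 * q ^ 6 * r * s ^ 5)
      - x ^ 4 * (p * s ^ 11 + 11 * q * r * s ^ 10)) =
    (x ^ 2 - 11 * x * y - y ^ 2) ^ 2 * (-(60 * (135 * c ^ 7 * d-328 * c ^ 4 * d ^ 3 + 112 * c * d ^ 5))) := by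
  obtain ⟨rfl, rfl, rfl, rfl, rfl, rfl⟩ := h
  ring

set_option maxRecDepth 100000 in
set_option maxHeartbeats 0 in
theorem bD_coef12 {R : Type*} [CommRing R] (x y p q r s c d : R)
    (h : BDData x y p q r s c d) :
    27 * (y ^ 4 * (q ^ 11 * s)
      - 11 * (x ^ 2 * y ^ 2) * (q ^ 6 * s ^ 6)
      - x ^ 4 * (q * s ^ 11)) =
    (x ^ 2 - 11 * x * y - y ^ 2) ^ 2 * (-(729 * c ^ 9 + 108 * c ^ 6 * d ^ 2-2896 * c ^ 3 * d ^ 4 + 1600 * d ^ 6)) := by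
  obtain ⟨rfl, rfl, rfl, rfl, rfl, rfl⟩ := h
  ring

set_option maxRecDepth 100000 in
set_option maxHeartbeats 0 in
theorem bD_aux {R : Type*} [CommRing R] (x y l m F G c d : R)
    (hF : F = l * (7 * x - y) + m * (17 * x ^ 3 + 187 * x ^ 2 * y + 119 * x * y ^ 2 + y ^ 3))
    (hG : G = l * (x + 7 * y) - m * (x ^ 3 - 119 * x ^ 2 * y + 187 * x * y ^ 2 - 17 * y ^ 3))
    (hc : c = x ^ 4 + 228 * x ^ 3 * y + 494 * x ^ 2 * y ^ 2 - 228 * x * y ^ 3 + y ^ 4)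
    (hd : d = -(x ^ 6) + 522 * x ^ 5 * y + 10005 * x ^ 4 * y ^ 2 + 10005 * x ^ 2 * y ^ 4
      - 522 * x * y ^ 5 - y ^ 6) :
    27 * (F * G * (y ^ 4 * F ^ 10 - 11 * (x ^ 2 * y ^ 2) * F ^ 5 * G ^ 5 - x ^ 4 * G ^ 10)) =
    (x ^ 2 - 11 * x * y - y ^ 2) ^ 2 *
  (-((125 * c ^ 3 + 64 * d ^ 2) * l ^ 12)
    - 1620 * c ^ 2 * d * l ^ 11 * m
    - 66 * (25 * c ^ 4 + 56 * c * d ^ 2) * l ^ 10 * m ^ 2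
    - 220 * (11 * c ^ 3 * d + 16 * d ^ 3) * l ^ 9 * m ^ 3
    + 1485 * (5 * c ^ 5 + 4 * c ^ 2 * d ^ 2) * l ^ 8 * m ^ 4
    + 792 * (53 * c ^ 4 * d + 28 * c * d ^ 3) * l ^ 7 * m ^ 5
    + 660 * (9 * c ^ 6 + 164 * c ^ 3 * d ^ 2 + 16 * d ^ 4) * l ^ 6 * m ^ 6
    + 2376 * (19 * c ^ 5 * d + 44 * c ^ 2 * d ^ 3) * l ^ 5 * m ^ 7
    + 495 * (27 * c ^ 7 + 104 * c ^ 4 * d ^ 2 + 112 * c * d ^ 4) * l ^ 4 * m ^ 8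
    + 220 * (81 * c ^ 6 * d + 136 * c ^ 3 * d ^ 3 + 80 * d ^ 5) * l ^ 3 * m ^ 9
    - 594 * (9 * c ^ 8 - 32 * c ^ 5 * d ^ 2 - 16 * c ^ 2 * d ^ 4) * l ^ 2 * m ^ 10
    - 60 * (135 * c ^ 7 * d - 328 * c ^ 4 * d ^ 3 + 112 * c * d ^ 5) * l * m ^ 11
    - (729 * c ^ 9 + 108 * c ^ 6 * d ^ 2 - 2896 * c ^ 3 * d ^ 4 + 1600 * d ^ 6)
        * m ^ 12) := by
  obtain ⟨p, hp⟩ : ∃ p, p = 7 * x - y := ⟨_, rfl⟩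
  obtain ⟨q, hq⟩ : ∃ q, q = 17 * x ^ 3 + 187 * x ^ 2 * y + 119 * x * y ^ 2 + y ^ 3 := ⟨_, rfl⟩
  obtain ⟨r, hr⟩ : ∃ r, r = x + 7 * y := ⟨_, rfl⟩
  obtain ⟨s, hs⟩ : ∃ s, s = -(x ^ 3 - 119 * x ^ 2 * y + 187 * x * y ^ 2 - 17 * y ^ 3) :=
    ⟨_, rfl⟩
  have hF2 : F = l * p + m * q := by rw [hF, hp, hq]
  have hG2 : G = l * r + m * s := by rw [hG, hr, hs]; ring
  have h : BDData x y p q r s c d := ⟨hp, hq, hr, hs, hc, hd⟩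
  have e0 := bD_coef0 x y p q r s c d h
  have e1 := bD_coef1 x y p q r s c d h
  have e2 := bD_coef2 x y p q r s c d h
  have e3 := bD_coef3 x y p q r s c d h
  have e4 := bD_coef4 x y p q r s c d h
  have e5 := bD_coef5 x y p q r s c d h
  have e6 := bD_coef6 x y p q r s c d h
  have e7 := bD_coef7 x y p q r s c d h
  have e8 := bD_coef8 x y p q r s c d h
  have e9 := bD_coef9 x y p q r s c d h
  have e10 := bD_coef10 x y p q r s c d h
  have e11 := bD_coef11 x y p q r s c d h
  have e12 := bD_coef12 x y p q r s c d h
  clear h hp hq hr hs hc hd hF hG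
  subst hF2 hG2
  linear_combination l ^ 12 * e0 + l ^ 11 * m * e1 + l ^ 10 * m ^ 2 * e2 + l ^ 9 * m ^ 3 * e3 + l ^ 8 * m ^ 4 * e4
    + l ^ 7 * m ^ 5 * e5 + l ^ 6 * m ^ 6 * e6 + l ^ 5 * m ^ 7 * e7 + l ^ 4 * m ^ 8 * e8 + l ^ 3 * m ^ 9 * e9
    + l ^ 2 * m ^ 10 * e10 + l * m ^ 11 * e11 + m ^ 12 * e12

set_option linter.unusedSimpArgs false

theorem aeval_Dpoly {S : Type*} [CommRing S] [Algebra ℚ S] (a b : S) :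
    aeval ![a, b] Dpoly = a * b * (a ^ 10 - 11 * a ^ 5 * b ^ 5 - b ^ 10) := by
  simp only [Dpoly, map_add, map_sub, map_mul, map_neg, map_pow, map_ofNat, aeval_X,
    Matrix.cons_val]

theorem aeval_c4poly {S : Type*} [CommRing S] [Algebra ℚ S] (a b : S) :
    aeval ![a, b] c4poly = a ^ 20 + 228 * a ^ 15 * b ^ 5 + 494 * a ^ 10 * b ^ 10
    - 228 * a ^ 5 * b ^ 15 + b ^ 20 := by
  simp only [c4poly, map_add, map_sub, map_mul, map_neg, map_pow, map_ofNat, aeval_X,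
    Matrix.cons_val]

theorem aeval_c6poly {S : Type*} [CommRing S] [Algebra ℚ S] (a b : S) :
    aeval ![a, b] c6poly = -(a ^ 30) + 522 * a ^ 25 * b ^ 5 + 10005 * a ^ 20 * b ^ 10
    + 10005 * a ^ 10 * b ^ 20 - 522 * a ^ 5 * b ^ 25 - b ^ 30 := by
  simp only [c6poly, map_add, map_sub, map_mul, map_neg, map_pow, map_ofNat, aeval_X,
    Matrix.cons_val]

theorem aeval_f7 {S : Type*} [CommRing S] [Algebra ℚ S] (a b : S) :
    aeval ![a, b] f7 = b ^ 2 * (7 * a ^ 5 - b ^ 5) := by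
  simp only [f7, map_add, map_sub, map_mul, map_neg, map_pow, map_ofNat, aeval_X,
    Matrix.cons_val]

theorem aeval_g7 {S : Type*} [CommRing S] [Algebra ℚ S] (a b : S) :
    aeval ![a, b] g7 = a ^ 2 * (a ^ 5 + 7 * b ^ 5) := by
  simp only [g7, map_add, map_sub, map_mul, map_neg, map_pow, map_ofNat, aeval_X,
    Matrix.cons_val]

theorem aeval_f17 {S : Type*} [CommRing S] [Algebra ℚ S] (a b : S) :
    aeval ![a, b] f17 = b ^ 2 * (17 * a ^ 15 + 187 * a ^ 10 * b ^ 5 + 119 * a ^ 5 * b ^ 10 + b ^ 15) := by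
  simp only [f17, map_add, map_sub, map_mul, map_neg, map_pow, map_ofNat, aeval_X,
    Matrix.cons_val]

theorem aeval_g17 {S : Type*} [CommRing S] [Algebra ℚ S] (a b : S) :
    aeval ![a, b] g17 = -(a ^ 2 * (a ^ 15 - 119 * a ^ 10 * b ^ 5 + 187 * a ^ 5 * b ^ 10 - 17 * b ^ 15)) := by
  simp only [g17, map_add, map_sub, map_mul, map_neg, map_pow, map_ofNat, aeval_X,
    Matrix.cons_val]

set_option maxHeartbeats 1000000 in
theorem aeval_bD {S : Type*} [CommRing S] [Algebra ℚ S] (a b c d : S) :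
    aeval ![a, b, c, d] bD = -((125 * a ^ 3 + 64 * b ^ 2) * c ^ 12)
    - 1620 * a ^ 2 * b * c ^ 11 * d
    - 66 * (25 * a ^ 4 + 56 * a * b ^ 2) * c ^ 10 * d ^ 2
    - 220 * (11 * a ^ 3 * b + 16 * b ^ 3) * c ^ 9 * d ^ 3
    + 1485 * (5 * a ^ 5 + 4 * a ^ 2 * b ^ 2) * c ^ 8 * d ^ 4
    + 792 * (53 * a ^ 4 * b + 28 * a * b ^ 3) * c ^ 7 * d ^ 5
    + 660 * (9 * a ^ 6 + 164 * a ^ 3 * b ^ 2 + 16 * b ^ 4) * c ^ 6 * d ^ 6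
    + 2376 * (19 * a ^ 5 * b + 44 * a ^ 2 * b ^ 3) * c ^ 5 * d ^ 7
    + 495 * (27 * a ^ 7 + 104 * a ^ 4 * b ^ 2 + 112 * a * b ^ 4) * c ^ 4 * d ^ 8
    + 220 * (81 * a ^ 6 * b + 136 * a ^ 3 * b ^ 3 + 80 * b ^ 5) * c ^ 3 * d ^ 9
    - 594 * (9 * a ^ 8 - 32 * a ^ 5 * b ^ 2 - 16 * a ^ 2 * b ^ 4) * c ^ 2 * d ^ 10
    - 60 * (135 * a ^ 7 * b - 328 * a ^ 4 * b ^ 3 + 112 * a * b ^ 5) * c * d ^ 11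
    - (729 * a ^ 9 + 108 * a ^ 6 * b ^ 2 - 2896 * a ^ 3 * b ^ 4 + 1600 * b ^ 6)
        * d ^ 12 := by
  simp only [bD, map_add, map_sub, map_mul, map_neg, map_pow, map_ofNat, aeval_X,
    Matrix.cons_val]

/-- The identity after evaluating every form, for arbitrary ring elements. -/
theorem bD_general {S : Type*} [CommRing S] [Algebra ℚ S] (a b l m : S) :
    27 * aeval ![l * aeval ![a, b] f7 + m * aeval ![a, b] f17,
          l * aeval ![a, b] g7 + m * aeval ![a, b] g17] Dpoly =
      (aeval ![a, b] Dpoly) ^ 2 *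
        aeval ![aeval ![a, b] c4poly, aeval ![a, b] c6poly, l, m] bD := by
  obtain ⟨F, hF⟩ : ∃ F, F = l * (7 * a ^ 5 - b ^ 5) + m * (17 * (a ^ 5) ^ 3
    + 187 * (a ^ 5) ^ 2 * b ^ 5 + 119 * a ^ 5 * (b ^ 5) ^ 2 + (b ^ 5) ^ 3) := ⟨_, rfl⟩
  obtain ⟨G, hG⟩ : ∃ G, G = l * (a ^ 5 + 7 * b ^ 5) - m * ((a ^ 5) ^ 3
    - 119 * (a ^ 5) ^ 2 * b ^ 5 + 187 * a ^ 5 * (b ^ 5) ^ 2 - 17 * (b ^ 5) ^ 3) := ⟨_, rfl⟩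
  have hu : l * aeval ![a, b] f7 + m * aeval ![a, b] f17 = b ^ 2 * F := by
    rw [hF, aeval_f7, aeval_f17]; ring
  have hv : l * aeval ![a, b] g7 + m * aeval ![a, b] g17 = a ^ 2 * G := by
    rw [hG, aeval_g7, aeval_g17]; ring
  rw [hu, hv, aeval_bD]
  obtain ⟨c, hc⟩ : ∃ c, c = aeval ![a, b] c4poly := ⟨_, rfl⟩
  obtain ⟨d, hd⟩ : ∃ d, d = aeval ![a, b] c6poly := ⟨_, rfl⟩
  rw [← hc, ← hd]
  have key := bD_aux (a ^ 5) (b ^ 5) l m F G c d hF hG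
    (by rw [hc, aeval_c4poly]; ring) (by rw [hd, aeval_c6poly]; ring)
  clear hu hv hc hd hF hG
  have h1 : aeval ![b ^ 2 * F, a ^ 2 * G] Dpoly = a ^ 2 * b ^ 2 *
    (F * G * ((b ^ 5) ^ 4 * F ^ 10 - 11 * ((a ^ 5) ^ 2 * (b ^ 5) ^ 2) * F ^ 5 * G ^ 5
      - (a ^ 5) ^ 4 * G ^ 10)) := by
    rw [aeval_Dpoly]; ring
  have h2 : aeval ![a, b] Dpoly = a * b *
      ((a ^ 5) ^ 2 - 11 * a ^ 5 * b ^ 5 - (b ^ 5) ^ 2) := by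
    rw [aeval_Dpoly]; ring
  rw [h1, h2]
  linear_combination a ^ 2 * b ^ 2 * key

set_option maxHeartbeats 1000000 in
/-- In `ℚ[a, b, λ, μ]` (with `a = X 0`, `b = X 1`, `λ = X 2`, `μ = X 3`) we have
`27 ⬝ D(λf7 + μf17, λg7 + μg17) = D(a,b)² ⬝ 𝐃(λ,μ)|_{c4 := c4(a,b), c6 := c6(a,b)}`. -/
theorem bD_identity :
    27 * (aeval
        ![X 2 * aeval ![X 0, X 1] f7 + X 3 * aeval ![X 0, X 1] f17,
          X 2 * aeval ![X 0, X 1] g7 + X 3 * aeval ![X 0, X 1] g17] Dpoly :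
        MvPolynomial (Fin 4) ℚ) =
      (aeval ![X 0, X 1] Dpoly : MvPolynomial (Fin 4) ℚ) ^ 2 *
        aeval ![aeval ![X 0, X 1] c4poly, aeval ![X 0, X 1] c6poly,
          (X 2 : MvPolynomial (Fin 4) ℚ), X 3] bD := by
  exact bD_general (X 0) (X 1) (X 2) (X 3)
end

section
/- In the polynomial ring Q[a, b, lam, mu] the identities 54^2 * c4(lam*f7 + mu*f17, lam*g7 + mu*g17) = bC4*(lam, mu) and 54^3 * c6(lam*f7 + mu*f17, lam*g7 + mu*g17) = bC6*(lam, mu) hold, where F(u,v) denotes the substitution a = u, b = v into the binary form F, and bC4*, bC6* denote the polynomials bC4(lam,mu), bC6(lam,mu) with the indeterminates c4 and c6 replaced by the binary forms c4(a,b) and c6(a,b) respectively. -/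
open MvPolynomial

/-- The polynomial `𝐂₄(λ,μ) = -(1/(11²·12²)) (𝐃_λλ 𝐃_μμ - 𝐃_λμ²)`. -/
noncomputable def bC4 : MvPolynomial (Fin 4) ℚ :=
  C (-(1 / (11 ^ 2 * 12 ^ 2)) : ℚ) *
    (pderiv 2 (pderiv 2 bD) * pderiv 3 (pderiv 3 bD) - (pderiv 2 (pderiv 3 bD)) ^ 2)

/-- The polynomial `𝐂₆(λ,μ) = -(1/(12·20)) (𝐃_λ (𝐂₄)_μ - 𝐃_μ (𝐂₄)_λ)`. -/
noncomputable def bC6 : MvPolynomial (Fin 4) ℚ :=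
  C (-(1 / (12 * 20)) : ℚ) *
    (pderiv 2 bD * pderiv 3 bC4 - pderiv 3 bD * pderiv 2 bC4)

set_option linter.unusedSimpArgs false

set_option maxHeartbeats 4000000 in
set_option maxRecDepth 100000 in
theorem key {R : Type*} [CommRing R] (x y l m P Q c4 c6 : R)
 (hP : P = l * (7*x-y) + m*(17*x^3+187*x^2*y+119*x*y^2+y^3))
 (hQ : Q = l * (x+7*y) - m*(x^3-119*x^2*y+187*x*y^2-17*y^3))
 (h4 : c4 = x^4+228*x^3*y+494*x^2*y^2-228*x*y^3+y^4)
 (h6 : c6 = -x^6+522*x^5*y+10005*x^4*y^2+10005*x^2*y^4-522*x*y^5-y^6) :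
 27 * (P*Q*(y^4*P^10-11*x^2*y^2*P^5*Q^5-x^4*Q^10)) = (x^2-11*x*y-y^2)^2 *
 (-((125 * c4 ^ 3 + 64 * c6 ^ 2) * l ^ 12)
    - 1620 * c4 ^ 2 * c6 * l ^ 11 * m
    - 66 * (25 * c4 ^ 4 + 56 * c4 * c6 ^ 2) * l ^ 10 * m ^ 2
    - 220 * (11 * c4 ^ 3 * c6 + 16 * c6 ^ 3) * l ^ 9 * m ^ 3
    + 1485 * (5 * c4 ^ 5 + 4 * c4 ^ 2 * c6 ^ 2) * l ^ 8 * m ^ 4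
    + 792 * (53 * c4 ^ 4 * c6 + 28 * c4 * c6 ^ 3) * l ^ 7 * m ^ 5
    + 660 * (9 * c4 ^ 6 + 164 * c4 ^ 3 * c6 ^ 2 + 16 * c6 ^ 4) * l ^ 6 * m ^ 6
    + 2376 * (19 * c4 ^ 5 * c6 + 44 * c4 ^ 2 * c6 ^ 3) * l ^ 5 * m ^ 7
    + 495 * (27 * c4 ^ 7 + 104 * c4 ^ 4 * c6 ^ 2 + 112 * c4 * c6 ^ 4) * l ^ 4 * m ^ 8
    + 220 * (81 * c4 ^ 6 * c6 + 136 * c4 ^ 3 * c6 ^ 3 + 80 * c6 ^ 5) * l ^ 3 * m ^ 9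
    - 594 * (9 * c4 ^ 8 - 32 * c4 ^ 5 * c6 ^ 2 - 16 * c4 ^ 2 * c6 ^ 4) * l ^ 2 * m ^ 10
    - 60 * (135 * c4 ^ 7 * c6 - 328 * c4 ^ 4 * c6 ^ 3 + 112 * c4 * c6 ^ 5) * l * m ^ 11
    - (729 * c4 ^ 9 + 108 * c4 ^ 6 * c6 ^ 2 - 2896 * c4 ^ 3 * c6 ^ 4 + 1600 * c6 ^ 6)
        * m ^ 12) := by
  subst hP hQ h4 h6
  ring

theorem chain_T (i : Fin 4)
    (p q : MvPolynomial (Fin 4) ℚ)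
    (r s : MvPolynomial (Fin 4) ℚ) (hr : pderiv i p = r) (hs : pderiv i q = s)
    (F : MvPolynomial (Fin 2) ℚ) :
    pderiv i (aeval ![p, q] F) =
      r * aeval ![p, q] (pderiv 0 F) + s * aeval ![p, q] (pderiv 1 F) := by
  induction F using MvPolynomial.induction_on with
  | C c => simp [-aeval_eq_bind₁, algebraMap_eq]
  | add F G hF hG => simp only [map_add, hF, hG]; ring
  | mul_X F j hF =>
    fin_cases j <;>
    · simp [-aeval_eq_bind₁, Derivation.leibniz, hF, hr, hs, pderiv_X, Pi.single_apply]
      ring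

theorem chain_S (p q : MvPolynomial (Fin 4) ℚ) (F : MvPolynomial (Fin 4) ℚ)
    (hp2 : pderiv 2 p = 0) (hp3 : pderiv 3 p = 0)
    (hq2 : pderiv 2 q = 0) (hq3 : pderiv 3 q = 0) :
    pderiv 2 (aeval ![p, q, X 2, X 3] F) = aeval ![p, q, X 2, X 3] (pderiv 2 F) ∧
    pderiv 3 (aeval ![p, q, X 2, X 3] F) = aeval ![p, q, X 2, X 3] (pderiv 3 F) := by
  induction F using MvPolynomial.induction_on with
  | C c => simp [-aeval_eq_bind₁, algebraMap_eq]
  | add F G hF hG => simp only [map_add, hF, hG]; simp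
  | mul_X F j hF =>
    obtain ⟨h2, h3⟩ := hF
    fin_cases j <;>
    · simp [-aeval_eq_bind₁, Derivation.leibniz, h2, h3, hp2, hp3, hq2, hq3, pderiv_X, Pi.single_apply]

theorem pd_lift (i : Fin 4) (h0 : i ≠ 0) (h1 : i ≠ 1) (F : MvPolynomial (Fin 2) ℚ) :
    pderiv i (aeval ![(X 0 : MvPolynomial (Fin 4) ℚ), X 1] F) = 0 := by
  induction F using MvPolynomial.induction_on with
  | C c => simp [-aeval_eq_bind₁, algebraMap_eq]
  | add F G hF hG => simp only [map_add, hF, hG]; simp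
  | mul_X F j hF =>
    fin_cases j <;>
    · simp [-aeval_eq_bind₁, Derivation.leibniz, hF, pderiv_X, Pi.single_apply, h0, h1, h0.symm, h1.symm]

theorem hess_D : pderiv 0 (pderiv 0 Dpoly) * pderiv 1 (pderiv 1 Dpoly)
    - pderiv 0 (pderiv 1 Dpoly) ^ 2 = -121 * c4poly := by
  have e (n : ℕ) [n.AtLeastTwo] : (OfNat.ofNat n : MvPolynomial (Fin 2) ℚ) = C (OfNat.ofNat n) := (map_ofNat C n).symm
  have d (n : ℕ) [n.AtLeastTwo] (i : Fin 2) : pderiv i (OfNat.ofNat n : MvPolynomial (Fin 2) ℚ) = 0 := by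
    rw [e, pderiv_C]
  simp [-aeval_eq_bind₁, Dpoly, c4poly, Derivation.leibniz, Derivation.leibniz_pow, pderiv_X, Pi.single_apply, d]
  ring

theorem comm_D : pderiv 1 (pderiv 0 Dpoly) = pderiv 0 (pderiv 1 Dpoly) := by
  have e (n : ℕ) [n.AtLeastTwo] : (OfNat.ofNat n : MvPolynomial (Fin 2) ℚ) = C (OfNat.ofNat n) := (map_ofNat C n).symm
  have d (n : ℕ) [n.AtLeastTwo] (i : Fin 2) : pderiv i (OfNat.ofNat n : MvPolynomial (Fin 2) ℚ) = 0 := by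
    rw [e, pderiv_C]
  simp [-aeval_eq_bind₁, Dpoly, Derivation.leibniz, Derivation.leibniz_pow, pderiv_X, Pi.single_apply, d]
  ring

theorem jac_D : pderiv 0 Dpoly * pderiv 1 c4poly - pderiv 1 Dpoly * pderiv 0 c4poly
    = 20 * c6poly := by
  have e (n : ℕ) [n.AtLeastTwo] : (OfNat.ofNat n : MvPolynomial (Fin 2) ℚ) = C (OfNat.ofNat n) := (map_ofNat C n).symm
  have d (n : ℕ) [n.AtLeastTwo] (i : Fin 2) : pderiv i (OfNat.ofNat n : MvPolynomial (Fin 2) ℚ) = 0 := by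
    rw [e, pderiv_C]
  simp [-aeval_eq_bind₁, Dpoly, c4poly, c6poly, Derivation.leibniz, Derivation.leibniz_pow, pderiv_X, Pi.single_apply, d]
  ring

theorem det_L : f7 * g17 - f17 * g7 = -24 * Dpoly ^ 2 := by
  simp only [f7, g7, f17, g17, Dpoly]; ring

set_option maxHeartbeats 1000000 in
theorem key_D :
    27 * (aeval
        ![X 2 * aeval ![X 0, X 1] f7 + X 3 * aeval ![X 0, X 1] f17,
          X 2 * aeval ![X 0, X 1] g7 + X 3 * aeval ![X 0, X 1] g17] Dpoly :
        MvPolynomial (Fin 4) ℚ) = (aeval ![X 0, X 1] Dpoly) ^ 2 *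
      aeval ![aeval ![X 0, X 1] c4poly, aeval ![X 0, X 1] c6poly,
        (X 2 : MvPolynomial (Fin 4) ℚ), X 3] bD := by
  have h := key (X 0 ^ 5 : MvPolynomial (Fin 4) ℚ) (X 1 ^ 5) (X 2) (X 3) _ _
    (aeval ![X 0, X 1] c4poly) (aeval ![X 0, X 1] c6poly) rfl rfl
    (by simp [-aeval_eq_bind₁, c4poly]; ring) (by simp [-aeval_eq_bind₁, c6poly]; ring)
  have hb : ∀ p q : MvPolynomial (Fin 4) ℚ, aeval ![p, q, (X 2 : MvPolynomial (Fin 4) ℚ), X 3] bD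
      = -((125 * p ^ 3 + 64 * q ^ 2) * X 2 ^ 12)
    - 1620 * p ^ 2 * q * X 2 ^ 11 * X 3
    - 66 * (25 * p ^ 4 + 56 * p * q ^ 2) * X 2 ^ 10 * X 3 ^ 2
    - 220 * (11 * p ^ 3 * q + 16 * q ^ 3) * X 2 ^ 9 * X 3 ^ 3
    + 1485 * (5 * p ^ 5 + 4 * p ^ 2 * q ^ 2) * X 2 ^ 8 * X 3 ^ 4
    + 792 * (53 * p ^ 4 * q + 28 * p * q ^ 3) * X 2 ^ 7 * X 3 ^ 5
    + 660 * (9 * p ^ 6 + 164 * p ^ 3 * q ^ 2 + 16 * q ^ 4) * X 2 ^ 6 * X 3 ^ 6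
    + 2376 * (19 * p ^ 5 * q + 44 * p ^ 2 * q ^ 3) * X 2 ^ 5 * X 3 ^ 7
    + 495 * (27 * p ^ 7 + 104 * p ^ 4 * q ^ 2 + 112 * p * q ^ 4) * X 2 ^ 4 * X 3 ^ 8
    + 220 * (81 * p ^ 6 * q + 136 * p ^ 3 * q ^ 3 + 80 * q ^ 5) * X 2 ^ 3 * X 3 ^ 9
    - 594 * (9 * p ^ 8 - 32 * p ^ 5 * q ^ 2 - 16 * p ^ 2 * q ^ 4) * X 2 ^ 2 * X 3 ^ 10
    - 60 * (135 * p ^ 7 * q - 328 * p ^ 4 * q ^ 3 + 112 * p * q ^ 5) * X 2 * X 3 ^ 11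
    - (729 * p ^ 9 + 108 * p ^ 6 * q ^ 2 - 2896 * p ^ 3 * q ^ 4 + 1600 * q ^ 6)
        * X 3 ^ 12 := by
    intro p q
    simp [-aeval_eq_bind₁, bD]
  rw [hb]
  generalize (-((125 * (aeval ![X 0, X 1] c4poly : MvPolynomial (Fin 4) ℚ) ^ 3 +
    64 * (aeval ![X 0, X 1] c6poly : MvPolynomial (Fin 4) ℚ) ^ 2) * X 2 ^ 12)
    - _ - _ - _ + _ + _ + _ + _ + _ + _ - _ - _ - _ : MvPolynomial (Fin 4) ℚ) = B at h ⊢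
  have hu : (X 2 * aeval ![X 0, X 1] f7 + X 3 * aeval ![X 0, X 1] f17 : MvPolynomial (Fin 4) ℚ) =
      X 1 ^ 2 * (X 2 * (7 * X 0 ^ 5 - X 1 ^ 5) + X 3 * (17 * (X 0 ^ 5) ^ 3
        + 187 * (X 0 ^ 5) ^ 2 * X 1 ^ 5 + 119 * X 0 ^ 5 * (X 1 ^ 5) ^ 2 + (X 1 ^ 5) ^ 3)) := by
    simp [-aeval_eq_bind₁, f7, f17]; ring
  have hv : (X 2 * aeval ![X 0, X 1] g7 + X 3 * aeval ![X 0, X 1] g17 : MvPolynomial (Fin 4) ℚ) =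
      X 0 ^ 2 * (X 2 * (X 0 ^ 5 + 7 * X 1 ^ 5) - X 3 * ((X 0 ^ 5) ^ 3
        - 119 * (X 0 ^ 5) ^ 2 * X 1 ^ 5 + 187 * X 0 ^ 5 * (X 1 ^ 5) ^ 2 - 17 * (X 1 ^ 5) ^ 3)) := by
    simp [-aeval_eq_bind₁, g7, g17]; ring
  rw [hu, hv]
  generalize (X 2 * (7 * X 0 ^ 5 - X 1 ^ 5) + X 3 * (17 * (X 0 ^ 5) ^ 3
        + 187 * (X 0 ^ 5) ^ 2 * X 1 ^ 5 + 119 * X 0 ^ 5 * (X 1 ^ 5) ^ 2 + (X 1 ^ 5) ^ 3)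
        : MvPolynomial (Fin 4) ℚ) = P at h ⊢
  generalize (X 2 * (X 0 ^ 5 + 7 * X 1 ^ 5) - X 3 * ((X 0 ^ 5) ^ 3
        - 119 * (X 0 ^ 5) ^ 2 * X 1 ^ 5 + 187 * X 0 ^ 5 * (X 1 ^ 5) ^ 2 - 17 * (X 1 ^ 5) ^ 3)
        : MvPolynomial (Fin 4) ℚ) = Q at h ⊢
  simp [-aeval_eq_bind₁, Dpoly]
  linear_combination (X 0 ^ 2 * X 1 ^ 2) * h

theorem lift_D_ne : (aeval ![X 0, X 1] Dpoly : MvPolynomial (Fin 4) ℚ) ≠ 0 := by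
  intro h
  have := congrArg (eval (fun _ => (1 : ℚ))) h
  simp [-aeval_eq_bind₁, Dpoly] at this

set_option maxHeartbeats 1000000 in
/-- In `ℚ[a, b, λ, μ]` (with `a = X 0`, `b = X 1`, `λ = X 2`, `μ = X 3`) we have
`54² ⬝ c4(λf7 + μf17, λg7 + μg17) = 𝐂₄(λ,μ)|_{c4 := c4(a,b), c6 := c6(a,b)}` and
`54³ ⬝ c6(λf7 + μf17, λg7 + μg17) = 𝐂₆(λ,μ)|_{c4 := c4(a,b), c6 := c6(a,b)}`. -/
theorem bC4_bC6_identity :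
    54 ^ 2 * (aeval
        ![X 2 * aeval ![X 0, X 1] f7 + X 3 * aeval ![X 0, X 1] f17,
          X 2 * aeval ![X 0, X 1] g7 + X 3 * aeval ![X 0, X 1] g17] c4poly :
        MvPolynomial (Fin 4) ℚ) =
      aeval ![aeval ![X 0, X 1] c4poly, aeval ![X 0, X 1] c6poly,
        (X 2 : MvPolynomial (Fin 4) ℚ), X 3] bC4 ∧
    54 ^ 3 * (aeval
        ![X 2 * aeval ![X 0, X 1] f7 + X 3 * aeval ![X 0, X 1] f17,
          X 2 * aeval ![X 0, X 1] g7 + X 3 * aeval ![X 0, X 1] g17] c6poly :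
        MvPolynomial (Fin 4) ℚ) =
      aeval ![aeval ![X 0, X 1] c4poly, aeval ![X 0, X 1] c6poly,
        (X 2 : MvPolynomial (Fin 4) ℚ), X 3] bC6 := by
  have hdet := congrArg (aeval ![(X 0 : MvPolynomial (Fin 4) ℚ), X 1]) det_L
  have hH := hess_D
  have hJ := jac_D
  have hE := key_D
  have hne := lift_D_ne
  have z2 := pd_lift 2 (by decide) (by decide)
  have z3 := pd_lift 3 (by decide) (by decide)
  have f2 := z2 f7
  have f3 := z3 f7
  have g2 := z2 g7
  have g3 := z3 g7
  have h2 := z2 f17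
  have h3 := z3 f17
  have k2 := z2 g17
  have k3 := z3 g17
  have D2 := z2 Dpoly
  have D3 := z3 Dpoly
  have S := fun F => chain_S _ _ F (z2 c4poly) (z3 c4poly) (z2 c6poly) (z3 c6poly)
  simp only [map_sub, map_mul, map_pow, map_neg, map_ofNat] at hdet
  generalize (aeval ![(X 0 : MvPolynomial (Fin 4) ℚ), X 1] f7) = f at *
  generalize (aeval ![(X 0 : MvPolynomial (Fin 4) ℚ), X 1] g7) = g at *
  generalize (aeval ![(X 0 : MvPolynomial (Fin 4) ℚ), X 1] f17) = h at *
  generalize (aeval ![(X 0 : MvPolynomial (Fin 4) ℚ), X 1] g17) = k at *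
  generalize (aeval ![(X 0 : MvPolynomial (Fin 4) ℚ), X 1] Dpoly) = d at *
  generalize (aeval ![(X 0 : MvPolynomial (Fin 4) ℚ), X 1] c4poly) = p at *
  generalize (aeval ![(X 0 : MvPolynomial (Fin 4) ℚ), X 1] c6poly) = q at *
  have T2 := fun F => chain_T 2 (X 2 * f + X 3 * h) (X 2 * g + X 3 * k) f g
    (by simp [-aeval_eq_bind₁, Derivation.leibniz, f2, h2, pderiv_X, Pi.single_apply])
    (by simp [-aeval_eq_bind₁, Derivation.leibniz, g2, k2, pderiv_X, Pi.single_apply]) F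
  have T3 := fun F => chain_T 3 (X 2 * f + X 3 * h) (X 2 * g + X 3 * k) h k
    (by simp [-aeval_eq_bind₁, Derivation.leibniz, f3, h3, pderiv_X, Pi.single_apply])
    (by simp [-aeval_eq_bind₁, Derivation.leibniz, g3, k3, pderiv_X, Pi.single_apply]) F
  have S2 := fun F => (S F).1
  have S3 := fun F => (S F).2
  clear S z2 z3
  have n2 : pderiv 2 (27 : MvPolynomial (Fin 4) ℚ) = 0 := by
    rw [show (27 : MvPolynomial (Fin 4) ℚ) = C 27 from (map_ofNat C 27).symm, pderiv_C]
  have n3 : pderiv 3 (27 : MvPolynomial (Fin 4) ℚ) = 0 := by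
    rw [show (27 : MvPolynomial (Fin 4) ℚ) = C 27 from (map_ofNat C 27).symm, pderiv_C]
  have m2 : pderiv 2 (54 : MvPolynomial (Fin 4) ℚ) = 0 := by
    rw [show (54 : MvPolynomial (Fin 4) ℚ) = C 54 from (map_ofNat C 54).symm, pderiv_C]
  have m3 : pderiv 3 (54 : MvPolynomial (Fin 4) ℚ) = 0 := by
    rw [show (54 : MvPolynomial (Fin 4) ℚ) = C 54 from (map_ofNat C 54).symm, pderiv_C]
  generalize (aeval ![X 2 * f + X 3 * h, X 2 * g + X 3 * k] :
    MvPolynomial (Fin 2) ℚ →ₐ[ℚ] MvPolynomial (Fin 4) ℚ) = T at *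
  generalize (aeval ![p, q, X 2, X 3] :
    MvPolynomial (Fin 4) ℚ →ₐ[ℚ] MvPolynomial (Fin 4) ℚ) = S at *
  have E2 := congrArg (pderiv 2) hE
  have E3 := congrArg (pderiv 3) hE
  simp only [Derivation.leibniz, Derivation.leibniz_pow, n2, n3, D2, D3, T2, T3, S2, S3,
    smul_eq_mul, smul_zero, mul_zero, add_zero] at E2 E3
  have E22 := congrArg (pderiv 2) E2
  have E23 := congrArg (pderiv 2) E3
  have E33 := congrArg (pderiv 3) E3
  simp only [Derivation.leibniz, Derivation.leibniz_pow, map_add, n2, n3, D2, D3, T2, T3, S2, S3,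
    f2, f3, g2, g3, h2, h3, k2, k3, comm_D,
    smul_eq_mul, smul_zero, mul_zero, add_zero] at E22 E23 E33
  have H := congrArg T hH
  have J := congrArg T hJ
  simp only [map_sub, map_mul, map_pow, map_neg, map_ofNat] at H J
  have c1 : (C (1 / (11 ^ 2 * 12 ^ 2)) : MvPolynomial (Fin 4) ℚ) * (121 * 144) = 1 := by
    rw [show (121 * 144 : MvPolynomial (Fin 4) ℚ) = C (121 * 144) by rw [C_mul, map_ofNat, map_ofNat], ← C_mul, ← C_1]
    norm_num
  have c2 : (C (1 / (12 * 20)) : MvPolynomial (Fin 4) ℚ) * 240 = 1 := by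
    rw [show (240 : MvPolynomial (Fin 4) ℚ) = C 240 from (map_ofNat C 240).symm, ← C_mul, ← C_1]
    norm_num
  have SC : ∀ c : ℚ, S (C c) = C c := fun c => by
    rw [← algebraMap_eq, AlgHom.commutes]
  have R4 : 54 ^ 2 * T c4poly = S bC4 := by
    have hb : S bC4 = -C (1 / (11 ^ 2 * 12 ^ 2)) * (S (pderiv 2 (pderiv 2 bD)) *
        S (pderiv 3 (pderiv 3 bD)) - S (pderiv 2 (pderiv 3 bD)) ^ 2) := by
      rw [bC4]; simp only [map_sub, map_mul, map_pow, SC]; simp only [C_neg]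
    rw [hb]
    generalize (C (1 / (11 ^ 2 * 12 ^ 2)) : MvPolynomial (Fin 4) ℚ) = c at *
    apply mul_left_cancel₀ (pow_ne_zero 4 hne)
    have A : d ^ 4 * (S (pderiv 2 (pderiv 2 bD)) *
        S (pderiv 3 (pderiv 3 bD)) - S (pderiv 2 (pderiv 3 bD)) ^ 2)
        = - (121 * 144) * 54 ^ 2 * d ^ 4 * T c4poly := by
      have A1 : d ^ 4 * (S (pderiv 2 (pderiv 2 bD)) *
        S (pderiv 3 (pderiv 3 bD)) - S (pderiv 2 (pderiv 3 bD)) ^ 2)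
        = 27 ^ 2 * (f * k - h * g) ^ 2 * (T (pderiv 0 (pderiv 0 Dpoly)) *
          T (pderiv 1 (pderiv 1 Dpoly)) - T (pderiv 0 (pderiv 1 Dpoly)) ^ 2) := by
        calc _ = (d ^ 2 * S (pderiv 2 (pderiv 2 bD))) * (d ^ 2 * S (pderiv 3 (pderiv 3 bD)))
              - (d ^ 2 * S (pderiv 2 (pderiv 3 bD))) ^ 2 := by ring
          _ = _ := by rw [← E22, ← E23, ← E33]; ring
      rw [A1, H, hdet]; ring
    linear_combination (-54 ^ 2 * d ^ 4 * T c4poly) * c1 + c * A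
  refine ⟨R4, ?_⟩
  have R2 := congrArg (pderiv 2) R4
  have R3 := congrArg (pderiv 3) R4
  simp only [Derivation.leibniz, Derivation.leibniz_pow, m2, m3, T2, T3, S2, S3,
    smul_eq_mul, smul_zero, mul_zero, add_zero] at R2 R3
  have hb : S bC6 = -C (1 / (12 * 20)) * (S (pderiv 2 bD) * S (pderiv 3 bC4)
      - S (pderiv 3 bD) * S (pderiv 2 bC4)) := by
    rw [bC6]; simp only [map_sub, map_mul, map_pow, SC]; simp only [C_neg]
  rw [hb]
  generalize (C (1 / (12 * 20)) : MvPolynomial (Fin 4) ℚ) = c at *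
  apply mul_left_cancel₀ (pow_ne_zero 2 hne)
  have A : d ^ 2 * (S (pderiv 2 bD) * S (pderiv 3 bC4) - S (pderiv 3 bD) * S (pderiv 2 bC4))
      = - 240 * 54 ^ 3 * d ^ 2 * T c6poly := by
    have A1 : d ^ 2 * (S (pderiv 2 bD) * S (pderiv 3 bC4) - S (pderiv 3 bD) * S (pderiv 2 bC4))
      = 27 * 54 ^ 2 * (f * k - h * g) * (T (pderiv 0 Dpoly) * T (pderiv 1 c4poly)
        - T (pderiv 1 Dpoly) * T (pderiv 0 c4poly)) := by
      calc _ = (d ^ 2 * S (pderiv 2 bD)) * S (pderiv 3 bC4)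
            - (d ^ 2 * S (pderiv 3 bD)) * S (pderiv 2 bC4) := by ring
        _ = _ := by rw [← E2, ← E3, ← R2, ← R3]; ring
    rw [A1, J, hdet]; ring
  linear_combination (-54 ^ 3 * d ^ 2 * T c6poly) * c2 + c * A
end
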